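/- In the purely fermionic case with Grassmann generators x`_1,…,x`_{2n}: for every integer k with 1 < k ≤ n, the space ℋ^f_k(x`_1,…,x`_{2n}) is the internal direct sum ℋ^f_k(x`_3,…,x`_{2n}) ⊕ ℋ^f_1(x`_1, x`_2)·ℋ^f_{k−1}(x`_3,…,x`_{2n}) ⊕ (x`_1 x`_2 + (1/(k−n−1))(x`_3 x`_4 + ⋯ + x`_{2n−1} x`_{2n}))·ℋ^f_{k−2}(x`_3,…,x`_{2n}); and for k = 1, ℋ^f_1(x`_1,…,x`_{2n}) = ℋ^f_1(x`_3,…,x`_{2n}) ⊕ ℋ^f_1(x`_1, x`_2). -/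

import Mathlib

set_option synthInstance.maxHeartbeats 1000000
set_option maxHeartbeats 1000000

noncomputable section

/-- The Grassmann algebra Λ_{2n} on `2n` anticommuting generators. -/
abbrev Grass (n : ℕ) := ExteriorAlgebra ℝ (Fin (2*n) → ℝ)

/-- The fermionic generator x`_i. -/
def fgen (n : ℕ) (i : Fin (2*n)) : Grass n :=
  ExteriorAlgebra.ι ℝ (Pi.single i (1:ℝ))

/-- The fermionic partial derivative ∂_{x`_i}, the odd derivation with
∂_{x`_i}(x`_j) = δ_{ij}: contraction with the i-th dual basis vector. -/
def fpderiv (n : ℕ) (i : Fin (2*n)) : Grass n →ₗ[ℝ] Grass n :=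
  CliffordAlgebra.contractLeft (LinearMap.proj i)

/-- The fermionic Laplace operator Δ_f = 4∑_j ∂_{x`_{2j−1}}∂_{x`_{2j}}. -/
def lapF (n : ℕ) : Grass n →ₗ[ℝ] Grass n :=
  (4:ℝ) • ∑ j : Fin n,
    (fpderiv n ⟨2*j.1, by omega⟩) ∘ₗ (fpderiv n ⟨2*j.1+1, by omega⟩)

/-- x`² = ∑_{j=1}^n x`_{2j−1} x`_{2j}. -/
def rf2 (n : ℕ) : Grass n := ∑ j : Fin n, fgen n ⟨2*j.1, by omega⟩ * fgen n ⟨2*j.1+1, by omega⟩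

/-- The degree-`k` homogeneous part 𝒫^f_k of the Grassmann algebra. -/
def Pf (n : ℕ) (k : ℕ) : Submodule ℝ (Grass n) :=
  (LinearMap.range (ExteriorAlgebra.ι ℝ (M := Fin (2*n) → ℝ)))^k

/-- The space ℋ^f_k of fermionic (symplectic) harmonics of degree k. -/
def Hf (n : ℕ) (k : ℕ) : Submodule ℝ (Grass n) :=
  Pf n k ⊓ LinearMap.ker (lapF n)

/-- The space ℋ^f_k(x`_i : i ∈ S): degree-k homogeneous elements of the Grassmann
subalgebra generated by the variables x`_i with i ∈ S, annihilated by Δ_f. -/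
def HfOn (n : ℕ) (S : Set (Fin (2*n))) (k : ℕ) : Submodule ℝ (Grass n) :=
  ((Submodule.span ℝ (fgen n '' S))^k) ⊓ LinearMap.ker (lapF n)

/-- The element x`_1 x`_2 + (1/(k−n−1))(x`_3 x`_4 + ⋯ + x`_{2n−1} x`_{2n}). -/
def gElem (n : ℕ) (hn : 1 ≤ n) (k : ℕ) : Grass n :=
  fgen n ⟨0, by omega⟩ * fgen n ⟨1, by omega⟩ +
    (((k:ℝ) - n - 1)⁻¹) •
      ∑ j : Fin n, if 1 ≤ j.1 then fgen n ⟨2*j.1, by omega⟩ * fgen n ⟨2*j.1+1, by omega⟩ else 0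

open Submodule

theorem fgen_mul_swap (n : ℕ) (i j : Fin (2*n)) :
    fgen n i * fgen n j = -(fgen n j * fgen n i) :=
  eq_neg_of_add_eq_zero_left (ExteriorAlgebra.ι_add_mul_swap _ _)

theorem fgen_mul_self (n : ℕ) (i : Fin (2*n)) : fgen n i * fgen n i = 0 :=
  ExteriorAlgebra.ι_sq_zero _

theorem fpderiv_fgen_mul (n : ℕ) (i j : Fin (2*n)) (f : Grass n) :
    fpderiv n i (fgen n j * f) = (if i = j then f else 0) - fgen n j * fpderiv n i f := by
  have h := CliffordAlgebra.contractLeft_ι_mul (Q := (0 : QuadraticForm ℝ (Fin (2*n) → ℝ)))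
    (LinearMap.proj i) (Pi.single j (1:ℝ)) f
  refine h.trans ?_
  congr 1
  rw [LinearMap.proj_apply, Pi.single_apply, ite_smul, one_smul, zero_smul]

theorem fpderiv_algebraMap (n : ℕ) (i : Fin (2*n)) (r : ℝ) :
    fpderiv n i (algebraMap ℝ (Grass n) r) = 0 :=
  CliffordAlgebra.contractLeft_algebraMap _ _ r

theorem fpderiv_comm (n : ℕ) (i j : Fin (2*n)) (f : Grass n) :
    fpderiv n i (fpderiv n j f) = -fpderiv n j (fpderiv n i f) :=
  CliffordAlgebra.contractLeft_comm _ _ f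

theorem lapF_apply (n : ℕ) (f : Grass n) :
    lapF n f = (4:ℝ) • ∑ j : Fin n,
      fpderiv n ⟨2*j.1, by omega⟩ (fpderiv n ⟨2*j.1+1, by omega⟩ f) := by
  simp [lapF]

/-- The generators of index at least `2` span the degree-one part of the smaller algebra. -/
abbrev tailSpan (n : ℕ) : Submodule ℝ (Grass n) := span ℝ (fgen n '' {i | 2 ≤ i.1})

/-- The span of the first two generators. -/
abbrev headSpan (n : ℕ) : Submodule ℝ (Grass n) := span ℝ (fgen n '' {i | i.1 < 2})

/-- The elements annihilated by the derivatives in the first two generators. -/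
def headConst (n : ℕ) : Submodule ℝ (Grass n) :=
  ⨅ i : {i : Fin (2*n) // i.1 < 2}, LinearMap.ker (fpderiv n i)

theorem mem_headConst {n : ℕ} {f : Grass n} :
    f ∈ headConst n ↔ ∀ i : Fin (2*n), i.1 < 2 → fpderiv n i f = 0 := by
  simp [headConst, Submodule.mem_iInf]

theorem tailSpan_pow_le_headConst (n k : ℕ) : tailSpan n ^ k ≤ headConst n := by
  intro f hf
  induction hf using Submodule.pow_induction_on_left' with
  | algebraMap r => exact mem_headConst.2 fun i _ => fpderiv_algebraMap n i r
  | add x y _ _ _ hx hy => exact add_mem hx hy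
  | mem_mul m hm _ x _ hx =>
    induction hm using Submodule.span_induction with
    | mem m hm =>
      obtain ⟨j, hj, rfl⟩ := hm
      refine mem_headConst.2 fun i hi => ?_
      have hij : i ≠ j := by
        rintro rfl
        exact absurd hi (not_lt.2 hj)
      rw [fpderiv_fgen_mul, if_neg hij, mem_headConst.1 hx i hi, mul_zero, sub_zero]
    | zero => rw [zero_mul]; exact zero_mem _
    | add a b _ _ ha hb => rw [add_mul]; exact add_mem ha hb
    | smul r a _ ha => rw [smul_mul_assoc]; exact Submodule.smul_mem _ r ha

theorem lapF_mem_headConst {n : ℕ} {f : Grass n} (hf : f ∈ headConst n) :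
    lapF n f ∈ headConst n := by
  rw [mem_headConst] at hf ⊢
  intro i hi
  rw [lapF_apply, map_smul, map_sum]
  refine smul_eq_zero_of_right _ (Finset.sum_eq_zero fun j _ => ?_)
  rw [fpderiv_comm, fpderiv_comm n i, hf i hi]
  simp

theorem lapF_fgen_zero_mul {n : ℕ} (hn : 1 ≤ n) (g : Grass n) :
    lapF n (fgen n ⟨0, by omega⟩ * g) =
      fgen n ⟨0, by omega⟩ * lapF n g - (4:ℝ) • fpderiv n ⟨1, by omega⟩ g := by
  have key : ∀ j : Fin n, fpderiv n ⟨2*j.1, by omega⟩ (fpderiv n ⟨2*j.1+1, by omega⟩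
      (fgen n ⟨0, by omega⟩ * g)) = fgen n ⟨0, by omega⟩ *
        fpderiv n ⟨2*j.1, by omega⟩ (fpderiv n ⟨2*j.1+1, by omega⟩ g) -
        (if j = ⟨0, hn⟩ then fpderiv n ⟨1, by omega⟩ g else 0) := by
    intro j
    rw [fpderiv_fgen_mul, if_neg (by simp [Fin.ext_iff]), zero_sub, map_neg, fpderiv_fgen_mul]
    by_cases h : j = ⟨0, hn⟩
    · subst h
      simp
    · rw [if_neg h, if_neg (by simpa [Fin.ext_iff] using h)]
      simp
  rw [lapF_apply, lapF_apply, Finset.sum_congr rfl fun j _ => key j, Finset.sum_sub_distrib,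
    Finset.sum_ite_eq' Finset.univ, if_pos (Finset.mem_univ _), smul_sub, ← Finset.mul_sum,
    mul_smul_comm]

theorem lapF_fgen_one_mul {n : ℕ} (hn : 1 ≤ n) (g : Grass n) :
    lapF n (fgen n ⟨1, by omega⟩ * g) =
      fgen n ⟨1, by omega⟩ * lapF n g + (4:ℝ) • fpderiv n ⟨0, by omega⟩ g := by
  have key : ∀ j : Fin n, fpderiv n ⟨2*j.1, by omega⟩ (fpderiv n ⟨2*j.1+1, by omega⟩
      (fgen n ⟨1, by omega⟩ * g)) = fgen n ⟨1, by omega⟩ *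
        fpderiv n ⟨2*j.1, by omega⟩ (fpderiv n ⟨2*j.1+1, by omega⟩ g) +
        (if j = ⟨0, hn⟩ then fpderiv n ⟨0, by omega⟩ g else 0) := by
    intro j
    rw [fpderiv_fgen_mul, map_sub, fpderiv_fgen_mul,
      if_neg (show ¬ (⟨2*j.1, _⟩ : Fin (2*n)) = ⟨1, _⟩ by simp only [Fin.ext_iff]; omega)]
    by_cases h : j = ⟨0, hn⟩
    · subst h
      simp [add_comm]
    · rw [if_neg h, if_neg (by simpa [Fin.ext_iff] using h)]
      simp
  rw [lapF_apply, lapF_apply, Finset.sum_congr rfl fun j _ => key j, Finset.sum_add_distrib,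
    Finset.sum_ite_eq' Finset.univ, if_pos (Finset.mem_univ _), smul_add, ← Finset.mul_sum,
    mul_smul_comm]

theorem fpderiv_zero_fgen_one_mul {n : ℕ} (hn : 1 ≤ n) {f : Grass n} (hf : f ∈ headConst n) :
    fpderiv n ⟨0, by omega⟩ (fgen n ⟨1, by omega⟩ * f) = 0 := by
  rw [fpderiv_fgen_mul, mem_headConst.1 hf _ (by simp)]
  simp

theorem fpderiv_zero_fgen_zero_mul {n : ℕ} (hn : 1 ≤ n) {f : Grass n} (hf : f ∈ headConst n) :
    fpderiv n ⟨0, by omega⟩ (fgen n ⟨0, by omega⟩ * f) = f := by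
  rw [fpderiv_fgen_mul, mem_headConst.1 hf _ (by simp)]
  simp

theorem fpderiv_one_fgen_one_mul {n : ℕ} (hn : 1 ≤ n) {f : Grass n} (hf : f ∈ headConst n) :
    fpderiv n ⟨1, by omega⟩ (fgen n ⟨1, by omega⟩ * f) = f := by
  rw [fpderiv_fgen_mul, mem_headConst.1 hf _ (by simp)]
  simp

theorem lapF_fgen_zero_mul_of_mem {n : ℕ} (hn : 1 ≤ n) {f : Grass n} (hf : f ∈ headConst n) :
    lapF n (fgen n ⟨0, by omega⟩ * f) = fgen n ⟨0, by omega⟩ * lapF n f := by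
  rw [lapF_fgen_zero_mul hn, mem_headConst.1 hf _ (by simp), smul_zero, sub_zero]

theorem lapF_fgen_one_mul_of_mem {n : ℕ} (hn : 1 ≤ n) {f : Grass n} (hf : f ∈ headConst n) :
    lapF n (fgen n ⟨1, by omega⟩ * f) = fgen n ⟨1, by omega⟩ * lapF n f := by
  rw [lapF_fgen_one_mul hn, mem_headConst.1 hf _ (by simp), smul_zero, add_zero]

theorem lapF_pair_mul_of_mem {n : ℕ} (hn : 1 ≤ n) {f : Grass n} (hf : f ∈ headConst n) :
    lapF n (fgen n ⟨0, by omega⟩ * (fgen n ⟨1, by omega⟩ * f)) =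
      fgen n ⟨0, by omega⟩ * (fgen n ⟨1, by omega⟩ * lapF n f) - (4:ℝ) • f := by
  rw [lapF_fgen_zero_mul hn, lapF_fgen_one_mul_of_mem hn hf, fpderiv_one_fgen_one_mul hn hf]

/-- The four components in the expansion along the first two generators are unique. -/
theorem eq_zero_of_expansion_eq_zero {n : ℕ} (hn : 1 ≤ n) {a b c d : Grass n} (ha : a ∈ headConst n)
    (hb : b ∈ headConst n) (hc : c ∈ headConst n) (hd : d ∈ headConst n)
    (h : a + fgen n ⟨0, by omega⟩ * b + fgen n ⟨1, by omega⟩ * c +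
      fgen n ⟨0, by omega⟩ * (fgen n ⟨1, by omega⟩ * d) = 0) :
    a = 0 ∧ b = 0 ∧ c = 0 ∧ d = 0 := by
  have h0 := congrArg (fpderiv n ⟨0, by omega⟩) h
  have h1 := congrArg (fpderiv n ⟨1, by omega⟩) h
  have h2 : fpderiv n ⟨0, by omega⟩ (fgen n ⟨0, by omega⟩ * (fgen n ⟨1, by omega⟩ * d)) =
      fgen n ⟨1, by omega⟩ * d := by
    rw [fpderiv_fgen_mul, fpderiv_zero_fgen_one_mul hn hd]
    simp
  rw [map_add, map_add, map_add, map_zero, mem_headConst.1 ha ⟨0, by omega⟩ zero_lt_two,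
    fpderiv_zero_fgen_zero_mul hn hb, fpderiv_zero_fgen_one_mul hn hc, h2, zero_add,
    add_zero] at h0
  have hd0 : d = 0 := by
    have := congrArg (fpderiv n ⟨1, by omega⟩) h0
    rwa [map_add, map_zero, mem_headConst.1 hb ⟨1, by omega⟩ one_lt_two, zero_add,
      fpderiv_one_fgen_one_mul hn hd] at this
  subst hd0
  have hb0 : b = 0 := by simpa using h0
  subst hb0
  have hc0 : c = 0 := by
    rwa [mul_zero, mul_zero, mul_zero, add_zero, add_zero, map_add, map_zero,
      mem_headConst.1 ha ⟨1, by omega⟩ one_lt_two, zero_add,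
      fpderiv_one_fgen_one_mul hn hc] at h1
  subst hc0
  exact ⟨by simpa using h, rfl, rfl, rfl⟩

/-- Euler's operator, written pair by pair. -/
theorem euler_of_mem_pow {n k : ℕ} {S : Set (Fin (2*n))} {f : Grass n}
    (hf : f ∈ span ℝ (fgen n '' S) ^ k) :
    ∑ j : Fin n, (fgen n ⟨2*j.1, by omega⟩ * fpderiv n ⟨2*j.1, by omega⟩ f +
      fgen n ⟨2*j.1+1, by omega⟩ * fpderiv n ⟨2*j.1+1, by omega⟩ f) = (k:ℝ) • f := by
  induction hf using Submodule.pow_induction_on_left' with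
  | algebraMap r => simp [fpderiv_algebraMap]
  | add x y i hx hy h1 h2 =>
    rw [smul_add, ← h1, ← h2, ← Finset.sum_add_distrib]
    refine Finset.sum_congr rfl fun j _ => ?_
    rw [map_add, map_add]
    noncomm_ring
  | mem_mul m hm i x hx ih =>
    induction hm using Submodule.span_induction with
    | mem m hm =>
      obtain ⟨l, -, rfl⟩ := hm
      have key : ∀ j : Fin n,
          fgen n ⟨2*j.1, by omega⟩ * fpderiv n ⟨2*j.1, by omega⟩ (fgen n l * x) +
          fgen n ⟨2*j.1+1, by omega⟩ * fpderiv n ⟨2*j.1+1, by omega⟩ (fgen n l * x) =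
          (if j = ⟨l.1 / 2, by omega⟩ then fgen n l * x else 0) +
          fgen n l * (fgen n ⟨2*j.1, by omega⟩ * fpderiv n ⟨2*j.1, by omega⟩ x +
            fgen n ⟨2*j.1+1, by omega⟩ * fpderiv n ⟨2*j.1+1, by omega⟩ x) := by
        intro j
        have hs : ∀ (i : Fin (2*n)) (y : Grass n),
            fgen n l * (fgen n i * y) = -(fgen n i * (fgen n l * y)) := by
          intro i y
          rw [← mul_assoc, fgen_mul_swap, neg_mul, mul_assoc]
        have hd : ∀ i : Fin (2*n), fgen n i * fpderiv n i (fgen n l * x) =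
            (if i = l then fgen n l * x else 0) + fgen n l * (fgen n i * fpderiv n i x) := by
          intro i
          rw [fpderiv_fgen_mul, hs, mul_sub, ← sub_eq_add_neg]
          by_cases h : i = l
          · subst h; simp
          · simp [h]
        have hi : (if j = ⟨l.1 / 2, by omega⟩ then fgen n l * x else 0) =
            (if (⟨2*j.1, by omega⟩ : Fin (2*n)) = l then fgen n l * x else 0) +
            (if (⟨2*j.1+1, by omega⟩ : Fin (2*n)) = l then fgen n l * x else 0) := by
          simp only [Fin.ext_iff]
          split_ifs <;> first | omega | simp
        rw [hd, hd, hi, mul_add]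
        abel
      rw [Finset.sum_congr rfl fun j _ => key j, Finset.sum_add_distrib, ← Finset.mul_sum, ih,
        Finset.sum_ite_eq' Finset.univ, if_pos (Finset.mem_univ _), mul_smul_comm]
      push_cast
      rw [add_smul, one_smul, add_comm]
    | zero => simp
    | add a b _ _ ha hb =>
      rw [add_mul, smul_add, ← ha, ← hb, ← Finset.sum_add_distrib]
      refine Finset.sum_congr rfl fun j _ => ?_
      rw [map_add, map_add]
      noncomm_ring
    | smul r a _ ha =>
      rw [smul_mul_assoc, smul_comm, ← ha, Finset.smul_sum]
      refine Finset.sum_congr rfl fun j _ => ?_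
      rw [map_smul, map_smul, mul_smul_comm, mul_smul_comm, smul_add]

theorem fpderiv_even_rf2_mul {n : ℕ} (j : Fin n) (f : Grass n) :
    fpderiv n ⟨2*j.1, by omega⟩ (rf2 n * f) =
      fgen n ⟨2*j.1+1, by omega⟩ * f + rf2 n * fpderiv n ⟨2*j.1, by omega⟩ f := by
  have key : ∀ l : Fin n, fpderiv n ⟨2*j.1, by omega⟩
      (fgen n ⟨2*l.1, by omega⟩ * fgen n ⟨2*l.1+1, by omega⟩ * f) =
      (if j = l then fgen n ⟨2*l.1+1, by omega⟩ * f else 0) +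
      fgen n ⟨2*l.1, by omega⟩ * fgen n ⟨2*l.1+1, by omega⟩ *
        fpderiv n ⟨2*j.1, by omega⟩ f := by
    intro l
    rw [mul_assoc, fpderiv_fgen_mul, fpderiv_fgen_mul,
      if_neg (show ¬ (⟨2*j.1, _⟩ : Fin (2*n)) = ⟨2*l.1+1, _⟩ by simp only [Fin.ext_iff]; omega)]
    simp [Fin.ext_iff, mul_assoc]
  rw [rf2, Finset.sum_mul, map_sum, Finset.sum_congr rfl fun l _ => key l,
    Finset.sum_add_distrib, Finset.sum_ite_eq Finset.univ, if_pos (Finset.mem_univ _),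
    Finset.sum_mul]

theorem fpderiv_odd_rf2_mul {n : ℕ} (j : Fin n) (f : Grass n) :
    fpderiv n ⟨2*j.1+1, by omega⟩ (rf2 n * f) =
      -(fgen n ⟨2*j.1, by omega⟩ * f) + rf2 n * fpderiv n ⟨2*j.1+1, by omega⟩ f := by
  have key : ∀ l : Fin n, fpderiv n ⟨2*j.1+1, by omega⟩
      (fgen n ⟨2*l.1, by omega⟩ * fgen n ⟨2*l.1+1, by omega⟩ * f) =
      (if j = l then -(fgen n ⟨2*l.1, by omega⟩ * f) else 0) +
      fgen n ⟨2*l.1, by omega⟩ * fgen n ⟨2*l.1+1, by omega⟩ *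
        fpderiv n ⟨2*j.1+1, by omega⟩ f := by
    intro l
    rw [mul_assoc, fpderiv_fgen_mul, fpderiv_fgen_mul,
      if_neg (show ¬ (⟨2*j.1+1, _⟩ : Fin (2*n)) = ⟨2*l.1, _⟩ by simp only [Fin.ext_iff]; omega)]
    by_cases h : j = l
    · subst h
      rw [if_pos rfl, if_pos rfl, mul_sub, mul_assoc]
      simp [sub_eq_neg_add, add_comm (-(fgen n _ * f))]
    · simp [h, Fin.ext_iff, Fin.val_inj, mul_assoc]
  rw [rf2, Finset.sum_mul, map_sum, Finset.sum_congr rfl fun l _ => key l,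
    Finset.sum_add_distrib, Finset.sum_ite_eq Finset.univ, if_pos (Finset.mem_univ _),
    Finset.sum_mul]

/-- The `sl₂` commutation relation between the Laplacian and multiplication by `rf2`. -/
theorem lapF_rf2_mul {n k : ℕ} {S : Set (Fin (2*n))} {f : Grass n}
    (hf : f ∈ span ℝ (fgen n '' S) ^ k) :
    lapF n (rf2 n * f) = (4 * ((k:ℝ) - n)) • f + rf2 n * lapF n f := by
  have key : ∀ j : Fin n, fpderiv n ⟨2*j.1, by omega⟩
      (fpderiv n ⟨2*j.1+1, by omega⟩ (rf2 n * f)) =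
      (fgen n ⟨2*j.1, by omega⟩ * fpderiv n ⟨2*j.1, by omega⟩ f +
        fgen n ⟨2*j.1+1, by omega⟩ * fpderiv n ⟨2*j.1+1, by omega⟩ f) - f +
      rf2 n * fpderiv n ⟨2*j.1, by omega⟩ (fpderiv n ⟨2*j.1+1, by omega⟩ f) := by
    intro j
    rw [fpderiv_odd_rf2_mul, map_add, map_neg, fpderiv_even_rf2_mul, fpderiv_fgen_mul, if_pos rfl]
    abel
  rw [lapF_apply, Finset.sum_congr rfl fun j _ => key j, Finset.sum_add_distrib,
    Finset.sum_sub_distrib, euler_of_mem_pow hf, ← Finset.mul_sum, lapF_apply, mul_smul_comm,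
    smul_add, Finset.sum_const, Finset.card_univ, Fintype.card_fin, ← Nat.cast_smul_eq_nsmul ℝ,
    ← sub_smul, smul_smul]

theorem pair_mem_tailSpan_sq {n : ℕ} (j : Fin n) (hj : 1 ≤ j.1) :
    fgen n ⟨2*j.1, by omega⟩ * fgen n ⟨2*j.1+1, by omega⟩ ∈ tailSpan n ^ 2 := by
  rw [pow_two]
  exact mul_mem_mul (subset_span ⟨_, by simp only [Set.mem_ofPred_eq]; omega, rfl⟩)
    (subset_span ⟨_, by simp only [Set.mem_ofPred_eq]; omega, rfl⟩)

theorem sum_tail_pairs {n : ℕ} (hn : 1 ≤ n) :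
    (∑ j : Fin n, if 1 ≤ j.1 then fgen n ⟨2*j.1, by omega⟩ * fgen n ⟨2*j.1+1, by omega⟩ else 0) =
      rf2 n - fgen n ⟨0, by omega⟩ * fgen n ⟨1, by omega⟩ := by
  have key : ∀ j : Fin n,
      (if 1 ≤ j.1 then fgen n ⟨2*j.1, by omega⟩ * fgen n ⟨2*j.1+1, by omega⟩ else 0) =
      fgen n ⟨2*j.1, by omega⟩ * fgen n ⟨2*j.1+1, by omega⟩ -
      (if j = ⟨0, hn⟩ then fgen n ⟨0, by omega⟩ * fgen n ⟨1, by omega⟩ else 0) := by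
    intro j
    by_cases h : j = ⟨0, hn⟩
    · subst h
      simp
    · have h1 : 1 ≤ j.1 := Nat.one_le_iff_ne_zero.2 fun h0 => h (Fin.ext h0)
      rw [if_pos h1, if_neg h, sub_zero]
  rw [Finset.sum_congr rfl fun j _ => key j, Finset.sum_sub_distrib,
    Finset.sum_ite_eq' Finset.univ, if_pos (Finset.mem_univ _), rf2]

theorem rf2_sub_pair_mem {n : ℕ} (hn : 1 ≤ n) :
    rf2 n - fgen n ⟨0, by omega⟩ * fgen n ⟨1, by omega⟩ ∈ tailSpan n ^ 2 := by
  rw [← sum_tail_pairs hn]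
  refine sum_mem fun j _ => ?_
  split_ifs with h
  · exact pair_mem_tailSpan_sq j h
  · exact zero_mem _

theorem gElem_eq {n : ℕ} (hn : 1 ≤ n) (k : ℕ) :
    gElem n hn k = fgen n ⟨0, by omega⟩ * fgen n ⟨1, by omega⟩ + (((k:ℝ) - n - 1)⁻¹) •
      (rf2 n - fgen n ⟨0, by omega⟩ * fgen n ⟨1, by omega⟩) := by
  rw [gElem, sum_tail_pairs hn]

theorem lapF_rf2_sub_pair_mul {n : ℕ} (hn : 1 ≤ n) {k : ℕ} {f : Grass n} (hf : f ∈ tailSpan n ^ k)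
    (h0 : lapF n f = 0) :
    lapF n ((rf2 n - fgen n ⟨0, by omega⟩ * fgen n ⟨1, by omega⟩) * f) =
      (4 * (((k + 2 : ℕ):ℝ) - n - 1)) • f := by
  rw [sub_mul, map_sub, lapF_rf2_mul hf, mul_assoc,
    lapF_pair_mul_of_mem hn (tailSpan_pow_le_headConst n k hf), h0]
  simp only [mul_zero, add_zero, zero_sub, sub_neg_eq_add]
  rw [← add_smul]
  congr 1
  push_cast
  ring

theorem headSpan_eq {n : ℕ} (hn : 1 ≤ n) :
    headSpan n = span ℝ {fgen n ⟨0, by omega⟩} ⊔ span ℝ {fgen n ⟨1, by omega⟩} := by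
  rw [← span_union]
  refine congrArg (span ℝ) (Set.ext fun f => ⟨?_, ?_⟩)
  · rintro ⟨i, hi, rfl⟩
    have hi : i.1 < 2 := hi
    have h : i = ⟨0, by omega⟩ ∨ i = ⟨1, by omega⟩ := by
      simp only [Fin.ext_iff]
      omega
    rcases h with h | h <;> rw [h] <;> simp
  · rintro (h | h)
    · exact ⟨_, show 0 < 2 from zero_lt_two, (Set.mem_singleton_iff.1 h).symm⟩
    · exact ⟨_, show 1 < 2 from one_lt_two, (Set.mem_singleton_iff.1 h).symm⟩

theorem range_ι_eq (n : ℕ) :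
    LinearMap.range (ExteriorAlgebra.ι ℝ (M := Fin (2*n) → ℝ)) = tailSpan n ⊔ headSpan n := by
  rw [LinearMap.range_eq_map, ← (Pi.basisFun ℝ (Fin (2*n))).span_eq, Submodule.map_span,
    ← span_union, ← Set.image_union]
  refine congrArg (span ℝ) (Set.ext fun f => ⟨?_, ?_⟩)
  · rintro ⟨_, ⟨i, rfl⟩, rfl⟩
    exact ⟨i, le_or_gt 2 i.1, by rw [Pi.basisFun_apply]; rfl⟩
  · rintro ⟨i, -, rfl⟩
    exact ⟨_, ⟨i, rfl⟩, by rw [Pi.basisFun_apply]; rfl⟩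

theorem tailSpan_le_range (n : ℕ) :
    tailSpan n ≤ LinearMap.range (ExteriorAlgebra.ι ℝ (M := Fin (2*n) → ℝ)) :=
  range_ι_eq n ▸ le_sup_left

theorem headSpan_le_range (n : ℕ) :
    headSpan n ≤ LinearMap.range (ExteriorAlgebra.ι ℝ (M := Fin (2*n) → ℝ)) :=
  range_ι_eq n ▸ le_sup_right

theorem span_fgen_mul_le (n : ℕ) (S T : Set (Fin (2*n))) :
    span ℝ (fgen n '' S) * span ℝ (fgen n '' T) ≤ span ℝ (fgen n '' T) * span ℝ (fgen n '' S) := by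
  rw [span_mul_span, span_le]
  rintro _ ⟨_, ⟨i, hi, rfl⟩, _, ⟨j, hj, rfl⟩, rfl⟩
  change fgen n i * fgen n j ∈ _
  rw [fgen_mul_swap]
  refine neg_mem ?_
  exact mul_mem_mul (subset_span ⟨j, hj, rfl⟩) (subset_span ⟨i, hi, rfl⟩)

theorem headSpan_mul_self_le {n : ℕ} (hn : 1 ≤ n) :
    headSpan n * headSpan n ≤ span ℝ {fgen n ⟨0, by omega⟩ * fgen n ⟨1, by omega⟩} := by
  rw [headSpan_eq hn, Submodule.sup_mul, Submodule.mul_sup, Submodule.mul_sup]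
  simp only [span_mul_span, Set.singleton_mul_singleton, fgen_mul_self]
  rw [fgen_mul_swap n ⟨1, _⟩ ⟨0, _⟩]
  simp

theorem headSpan_mul_self_mul_self {n : ℕ} (hn : 1 ≤ n) :
    headSpan n * (headSpan n * headSpan n) = ⊥ := by
  refine le_bot_iff.1 ((mul_le_mul_right (headSpan_mul_self_le hn) _).trans ?_)
  rw [headSpan_eq hn, Submodule.sup_mul]
  simp only [span_mul_span, Set.singleton_mul_singleton, ← mul_assoc, fgen_mul_self]
  rw [fgen_mul_swap n ⟨1, _⟩ ⟨0, _⟩, neg_mul, mul_assoc, fgen_mul_self]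
  simp

theorem range_ι_pow_le {n : ℕ} (hn : 1 ≤ n) (k : ℕ) :
    LinearMap.range (ExteriorAlgebra.ι ℝ (M := Fin (2*n) → ℝ)) ^ (k + 2) ≤
      tailSpan n ^ (k + 2) ⊔ headSpan n * tailSpan n ^ (k + 1) ⊔
        headSpan n * headSpan n * tailSpan n ^ k := by
  rw [range_ι_eq]
  have hc : tailSpan n * headSpan n = headSpan n * tailSpan n :=
    le_antisymm (span_fgen_mul_le n _ _) (span_fgen_mul_le n _ _)
  have hz := headSpan_mul_self_mul_self hn
  generalize tailSpan n = W at *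
  generalize headSpan n = U at *
  have hz' : ∀ P, U * (U * U * P) = ⊥ := fun P => by rw [← mul_assoc, hz, bot_mul]
  have h1 : ∀ P, W * (U * P) = U * (W * P) := fun P => by rw [← mul_assoc, hc, mul_assoc]
  induction k with
  | zero =>
    rw [pow_two, pow_two, Submodule.sup_mul, Submodule.mul_sup, Submodule.mul_sup, hc,
      zero_add, pow_one, pow_zero, mul_one]
    exact le_of_eq (by simp only [sup_left_comm, sup_comm, sup_left_idem])
  | succ k ih =>
    rw [pow_succ' (W ⊔ U)]
    refine (mul_le_mul_right ih _).trans ?_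
    simp only [Submodule.sup_mul, Submodule.mul_sup, hz']
    simp only [mul_assoc, h1, ← pow_succ', add_assoc, Nat.reduceAdd]
    generalize W ^ (k + 3) = X
    generalize U * W ^ (k + 2) = Y
    generalize U * (U * W ^ (k + 1)) = Z
    exact sup_le (sup_le le_sup_left (sup_le (le_sup_of_le_left le_sup_right) le_sup_right))
      (sup_le le_sup_right bot_le)

theorem exists_of_mem_headSpan_mul {n : ℕ} (hn : 1 ≤ n) {P : Submodule ℝ (Grass n)} {f : Grass n}
    (hf : f ∈ headSpan n * P) :
    ∃ b ∈ P, ∃ c ∈ P, f = fgen n ⟨0, by omega⟩ * b + fgen n ⟨1, by omega⟩ * c := by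
  rw [headSpan_eq hn, Submodule.sup_mul] at hf
  obtain ⟨_, hu, _, hv, rfl⟩ := mem_sup.1 hf
  obtain ⟨b, hb, rfl⟩ := mem_span_singleton_mul.1 hu
  obtain ⟨c, hc, rfl⟩ := mem_span_singleton_mul.1 hv
  exact ⟨b, hb, c, hc, rfl⟩

theorem fgen_mem_headSpan {n : ℕ} (i : Fin (2*n)) (hi : i.1 < 2) : fgen n i ∈ headSpan n :=
  subset_span ⟨i, hi, rfl⟩

theorem exists_expansion {n : ℕ} (hn : 1 ≤ n) {k : ℕ} {f : Grass n} (hf : f ∈ Pf n (k + 2)) :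
    ∃ a ∈ tailSpan n ^ (k + 2), ∃ b ∈ tailSpan n ^ (k + 1), ∃ c ∈ tailSpan n ^ (k + 1),
      ∃ d ∈ tailSpan n ^ k, f = a + fgen n ⟨0, by omega⟩ * b + fgen n ⟨1, by omega⟩ * c +
        fgen n ⟨0, by omega⟩ * (fgen n ⟨1, by omega⟩ * d) := by
  obtain ⟨_, hu, w, hw, rfl⟩ := mem_sup.1 (range_ι_pow_le hn k hf)
  obtain ⟨a, ha, v, hv, rfl⟩ := mem_sup.1 hu
  obtain ⟨b, hb, c, hc, rfl⟩ := exists_of_mem_headSpan_mul hn hv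
  obtain ⟨d, hd, rfl⟩ := mem_span_singleton_mul.1 (mul_le_mul_left (headSpan_mul_self_le hn) _ hw)
  exact ⟨a, ha, b, hb, c, hc, d, hd, by rw [add_assoc a (_ * b), mul_assoc]⟩

theorem lapF_expansion {n : ℕ} (hn : 1 ≤ n) {a b c d : Grass n} (ha : a ∈ headConst n)
    (hb : b ∈ headConst n) (hc : c ∈ headConst n) (hd : d ∈ headConst n)
    (h : lapF n (a + fgen n ⟨0, by omega⟩ * b + fgen n ⟨1, by omega⟩ * c +
      fgen n ⟨0, by omega⟩ * (fgen n ⟨1, by omega⟩ * d)) = 0) :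
    lapF n a = (4:ℝ) • d ∧ lapF n b = 0 ∧ lapF n c = 0 ∧ lapF n d = 0 := by
  rw [map_add, map_add, map_add, lapF_fgen_zero_mul_of_mem hn hb,
    lapF_fgen_one_mul_of_mem hn hc, lapF_pair_mul_of_mem hn hd] at h
  obtain ⟨h1, h2⟩ := eq_zero_of_expansion_eq_zero hn
    (sub_mem (lapF_mem_headConst ha) (Submodule.smul_mem _ (4:ℝ) hd)) (lapF_mem_headConst hb)
    (lapF_mem_headConst hc) (lapF_mem_headConst hd) (by rw [← h]; abel)
  exact ⟨sub_eq_zero.1 h1, h2⟩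

theorem lapF_of_mem_range_ι {n : ℕ} {f : Grass n}
    (hf : f ∈ LinearMap.range (ExteriorAlgebra.ι ℝ (M := Fin (2*n) → ℝ))) : lapF n f = 0 := by
  obtain ⟨v, rfl⟩ := hf
  rw [lapF_apply]
  refine smul_eq_zero_of_right _ (Finset.sum_eq_zero fun j _ => ?_)
  have h : fpderiv n ⟨2*j.1+1, by omega⟩ (ExteriorAlgebra.ι ℝ v) =
      algebraMap ℝ (Grass n) (v ⟨2*j.1+1, by omega⟩) :=
    CliffordAlgebra.contractLeft_ι (Q := (0 : QuadraticForm ℝ (Fin (2*n) → ℝ))) (LinearMap.proj _) v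
  rw [h, fpderiv_algebraMap]

theorem HfOn_one {n : ℕ} (S : Set (Fin (2*n)))
    (h : span ℝ (fgen n '' S) ≤ LinearMap.range (ExteriorAlgebra.ι ℝ (M := Fin (2*n) → ℝ))) :
    HfOn n S 1 = span ℝ (fgen n '' S) := by
  rw [HfOn, pow_one]
  exact inf_eq_left.2 fun f hf => lapF_of_mem_range_ι (h hf)

theorem Hf_one_eq {n : ℕ} : Hf n 1 = HfOn n {i | 2 ≤ i.1} 1 ⊔ HfOn n {i | i.1 < 2} 1 := by
  rw [HfOn_one _ (tailSpan_le_range n), HfOn_one _ (headSpan_le_range n), ← range_ι_eq, Hf, Pf,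
    pow_one]
  exact inf_eq_left.2 fun f hf => lapF_of_mem_range_ι hf

theorem disjoint_HfOn_one {n : ℕ} (hn : 1 ≤ n) :
    Disjoint (HfOn n {i | 2 ≤ i.1} 1) (HfOn n {i | i.1 < 2} 1) := by
  rw [HfOn_one _ (tailSpan_le_range n), HfOn_one _ (headSpan_le_range n), disjoint_def]
  intro f hf hf'
  have hone : (1 : Submodule ℝ (Grass n)) ≤ headConst n := by
    simpa using tailSpan_pow_le_headConst n 0
  obtain ⟨b, hb, c, hc, h⟩ := exists_of_mem_headSpan_mul hn (P := 1) (by rwa [mul_one])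
  have hf1 : f ∈ headConst n := tailSpan_pow_le_headConst n 1 (by rwa [pow_one])
  have := eq_zero_of_expansion_eq_zero hn (neg_mem hf1) (hone hb) (hone hc) (zero_mem _)
    (by rw [h]; noncomm_ring)
  exact neg_eq_zero.1 this.1

theorem gElem_mul_mem_Hf {n : ℕ} (hn : 1 ≤ n) {k : ℕ} (hk : k + 2 ≤ n) {h : Grass n}
    (hh : h ∈ HfOn n {i | 2 ≤ i.1} k) : gElem n hn (k + 2) * h ∈ Hf n (k + 2) := by
  obtain ⟨hd, h0⟩ := hh
  replace h0 : lapF n h = 0 := h0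
  have hle := tailSpan_le_range n
  rw [gElem_eq]
  refine ⟨?_, ?_⟩
  · rw [Pf, add_comm k, pow_add]
    refine mul_mem_mul (add_mem ?_ (Submodule.smul_mem _ _ ?_)) (pow_le_pow_left' hle _ hd)
    · rw [pow_two]
      exact mul_mem_mul ⟨_, rfl⟩ ⟨_, rfl⟩
    · exact pow_le_pow_left' hle _ (rf2_sub_pair_mem hn)
  · have hc : (((k + 2 : ℕ):ℝ) - n - 1) ≠ 0 := by
      have : ((k + 2 : ℕ):ℝ) ≤ n := by exact_mod_cast hk
      linarith
    refine LinearMap.mem_ker.2 ?_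
    rw [add_mul, map_add, smul_mul_assoc, map_smul,
      lapF_rf2_sub_pair_mul hn hd h0, mul_assoc,
      lapF_pair_mul_of_mem hn (tailSpan_pow_le_headConst n k hd), h0, smul_smul,
      mul_left_comm, inv_mul_cancel₀ hc]
    simp

theorem HfOn_le_Hf (n k : ℕ) : HfOn n {i | 2 ≤ i.1} k ≤ Hf n k :=
  inf_le_inf_right _ (pow_le_pow_left' (tailSpan_le_range n) _)

theorem head_mul_HfOn_le_Hf {n : ℕ} (hn : 1 ≤ n) (k : ℕ) :
    HfOn n {i | i.1 < 2} 1 * HfOn n {i | 2 ≤ i.1} k ≤ Hf n (k + 1) := by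
  rw [HfOn_one _ (headSpan_le_range n)]
  refine fun f hf => ⟨?_, ?_⟩
  · rw [Pf, pow_succ']
    exact mul_le_mul' (headSpan_le_range n)
      (inf_le_left.trans (pow_le_pow_left' (tailSpan_le_range n) k)) hf
  · obtain ⟨b, hb, c, hc, rfl⟩ := exists_of_mem_headSpan_mul hn hf
    refine LinearMap.mem_ker.2 ?_
    rw [map_add,
      lapF_fgen_zero_mul_of_mem hn (tailSpan_pow_le_headConst n k hb.1),
      lapF_fgen_one_mul_of_mem hn (tailSpan_pow_le_headConst n k hc.1),
      LinearMap.mem_ker.1 hb.2, LinearMap.mem_ker.1 hc.2, mul_zero, mul_zero, add_zero]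

theorem Hf_le_sup {n : ℕ} (hn : 1 ≤ n) {k : ℕ} (hk : k + 2 ≤ n) :
    Hf n (k + 2) ≤ HfOn n {i | 2 ≤ i.1} (k + 2) ⊔
      HfOn n {i | i.1 < 2} 1 * HfOn n {i | 2 ≤ i.1} (k + 1) ⊔
      Submodule.map (LinearMap.mulLeft ℝ (gElem n hn (k + 2))) (HfOn n {i | 2 ≤ i.1} k) := by
  rintro f ⟨hf, hf0⟩
  obtain ⟨a, ha, b, hb, c, hc, d, hd, rfl⟩ := exists_expansion hn hf
  obtain ⟨ha0, hb0, hc0, hd0⟩ := lapF_expansion hn (tailSpan_pow_le_headConst n _ ha)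
    (tailSpan_pow_le_headConst n _ hb) (tailSpan_pow_le_headConst n _ hc)
    (tailSpan_pow_le_headConst n _ hd) hf0
  have hne : (((k + 2 : ℕ):ℝ) - n - 1) ≠ 0 := by
    have : ((k + 2 : ℕ):ℝ) ≤ n := by exact_mod_cast hk
    linarith
  have hsplit : a + fgen n ⟨0, by omega⟩ * b + fgen n ⟨1, by omega⟩ * c +
      fgen n ⟨0, by omega⟩ * (fgen n ⟨1, by omega⟩ * d) =
      (a - ((((k + 2 : ℕ):ℝ) - n - 1)⁻¹) •
        ((rf2 n - fgen n ⟨0, by omega⟩ * fgen n ⟨1, by omega⟩) * d)) +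
      (fgen n ⟨0, by omega⟩ * b + fgen n ⟨1, by omega⟩ * c) + gElem n hn (k + 2) * d := by
    rw [gElem_eq, add_mul, smul_mul_assoc, mul_assoc (fgen n ⟨0, _⟩) (fgen n ⟨1, _⟩) d]
    abel
  rw [hsplit]
  refine add_mem_sup (add_mem_sup ⟨sub_mem ha (Submodule.smul_mem _ _ ?_), ?_⟩
    (add_mem (mul_mem_mul ?_ ⟨hb, hb0⟩) (mul_mem_mul ?_ ⟨hc, hc0⟩))) ⟨d, ⟨hd, hd0⟩, rfl⟩
  · change _ ∈ tailSpan n ^ (k + 2)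
    rw [add_comm k, pow_add]
    exact mul_mem_mul (rf2_sub_pair_mem hn) hd
  · refine LinearMap.mem_ker.2 ?_
    rw [map_sub, map_smul, lapF_rf2_sub_pair_mul hn hd hd0, ha0, smul_smul,
      mul_left_comm, inv_mul_cancel₀ hne, mul_one, sub_self]
  · rw [HfOn_one _ (headSpan_le_range n)]
    exact fgen_mem_headSpan _ zero_lt_two
  · rw [HfOn_one _ (headSpan_le_range n)]
    exact fgen_mem_headSpan _ one_lt_two

theorem eq_zero_of_branching_sum_eq_zero {n : ℕ} (hn : 1 ≤ n) {k : ℕ} {u v w : Grass n}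
    (hu : u ∈ HfOn n {i | 2 ≤ i.1} (k + 2))
    (hv : v ∈ HfOn n {i | i.1 < 2} 1 * HfOn n {i | 2 ≤ i.1} (k + 1))
    (hw : w ∈ Submodule.map (LinearMap.mulLeft ℝ (gElem n hn (k + 2)))
      (HfOn n {i | 2 ≤ i.1} k)) (h : u + v + w = 0) : u = 0 ∧ v = 0 ∧ w = 0 := by
  rw [HfOn_one _ (headSpan_le_range n)] at hv
  obtain ⟨b, hb, c, hc, rfl⟩ := exists_of_mem_headSpan_mul hn hv
  obtain ⟨d, hd, rfl⟩ := hw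
  have hmem : (rf2 n - fgen n ⟨0, by omega⟩ * fgen n ⟨1, by omega⟩) * d ∈
      tailSpan n ^ (2 + k) := by
    rw [pow_add]
    exact mul_mem_mul (rf2_sub_pair_mem hn) hd.1
  rw [LinearMap.mulLeft_apply, gElem_eq, add_mul, smul_mul_assoc, mul_assoc (fgen n _)] at h
  obtain ⟨-, rfl, rfl, rfl⟩ := eq_zero_of_expansion_eq_zero hn
    (add_mem (tailSpan_pow_le_headConst n _ hu.1)
      (Submodule.smul_mem _ ((((k + 2 : ℕ):ℝ) - n - 1)⁻¹) (tailSpan_pow_le_headConst n _ hmem)))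
    (tailSpan_pow_le_headConst n _ hb.1) (tailSpan_pow_le_headConst n _ hc.1)
    (tailSpan_pow_le_headConst n _ hd.1) (by rw [← h]; abel)
  simpa using h

theorem iSupIndep_fin_three_of_sum_eq_zero {R M : Type*} [Ring R] [AddCommGroup M] [Module R M]
    {A B C : Submodule R M}
    (h : ∀ a ∈ A, ∀ b ∈ B, ∀ c ∈ C, a + b + c = 0 → a = 0 ∧ b = 0 ∧ c = 0) :
    iSupIndep ![A, B, C] := by
  classical
  rw [iSupIndep_iff_dfinsupp_lsum_injective, injective_iff_map_eq_zero]
  intro v hv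
  rw [DFinsupp.lsum_apply_apply, DFinsupp.sumAddHom_apply, DFinsupp.sum_eq_sum_fintype _
    (fun _ => by simp), Fin.sum_univ_three] at hv
  obtain ⟨h0, h1, h2⟩ := h _ (v 0).2 _ (v 1).2 _ (v 2).2 hv
  ext i
  fin_cases i
  · exact h0
  · exact h1
  · exact h2

/-- for 1 < k ≤ n, ℋ^f_k(x`_1,…,x`_{2n}) is the internal direct sum of
ℋ^f_k(x`_3,…,x`_{2n}), ℋ^f_1(x`_1,x`_2)·ℋ^f_{k−1}(x`_3,…,x`_{2n}) and
(x`_1x`_2 + (1/(k−n−1))(x`_3x`_4 + ⋯ + x`_{2n−1}x`_{2n}))·ℋ^f_{k−2}(x`_3,…,x`_{2n});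
and ℋ^f_1(x`_1,…,x`_{2n}) = ℋ^f_1(x`_3,…,x`_{2n}) ⊕ ℋ^f_1(x`_1,x`_2). -/
theorem Hf_branching (n : ℕ) (hn : 1 ≤ n) :
    (∀ k : ℕ, 1 < k → k ≤ n →
      Hf n k = (⨆ i : Fin 3,
          ![HfOn n {i | 2 ≤ i.1} k,
            HfOn n {i | i.1 < 2} 1 * HfOn n {i | 2 ≤ i.1} (k-1),
            Submodule.map (LinearMap.mulLeft ℝ (gElem n hn k)) (HfOn n {i | 2 ≤ i.1} (k-2))] i) ∧
        iSupIndep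
          ![HfOn n {i | 2 ≤ i.1} k,
            HfOn n {i | i.1 < 2} 1 * HfOn n {i | 2 ≤ i.1} (k-1),
            Submodule.map (LinearMap.mulLeft ℝ (gElem n hn k)) (HfOn n {i | 2 ≤ i.1} (k-2))]) ∧
    (Hf n 1 = HfOn n {i | 2 ≤ i.1} 1 ⊔ HfOn n {i | i.1 < 2} 1 ∧
      Disjoint (HfOn n {i | 2 ≤ i.1} 1) (HfOn n {i | i.1 < 2} 1)) := by
  refine ⟨fun k hk hkn => ?_, Hf_one_eq, disjoint_HfOn_one hn⟩
  obtain ⟨k, rfl⟩ := Nat.exists_eq_add_of_le' (Nat.succ_le_of_lt hk)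
  refine ⟨?_, iSupIndep_fin_three_of_sum_eq_zero fun u hu v hv w hw h =>
    eq_zero_of_branching_sum_eq_zero hn hu hv hw h⟩
  rw [iSup_fin_three]
  refine le_antisymm (Hf_le_sup hn hkn) (sup_le (sup_le (HfOn_le_Hf n _) ?_) ?_)
  · exact head_mul_HfOn_le_Hf hn (k + 1)
  · exact Submodule.map_le_iff_le_comap.2 fun h hh => gElem_mul_mem_Hf hn hkn hh


end
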